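/- Let n be a positive odd integer with n ≥ 154, n ≡ 3 (mod 5) and n ≡ 2 (mod 3). Then for every finite abelian group H of order n²+n+1 there exist no inverse-closed subsets T₀, T₁ of H with e ∈ T₀ satisfying the APLL group-ring equations. -/

import Mathlib

open scoped Classical Pointwise

/-- The APLL group-ring equations, stated via coefficient counts: for every `h ∈ H`,
`#{(a,b) ∈ T₀×T₁ : ab = h} = 1 − [h = e]`, and
`#{(a,b) ∈ T₀×T₀ : ab = h} + #{(a,b) ∈ T₁×T₁ : ab = h} + #{t ∈ T₀ : t² = h}
  + #{t ∈ T₁ : t² = h} = 2 + 2n·[h = e]`. -/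
def APLLEqs {H : Type*} [CommGroup H] (n : ℕ) (T₀ T₁ : Set H) : Prop :=
  (∀ h : H,
      {p : H × H | p.1 ∈ T₀ ∧ p.2 ∈ T₁ ∧ p.1 * p.2 = h}.ncard
        = if h = 1 then 0 else 1) ∧
  (∀ h : H,
      {p : H × H | p.1 ∈ T₀ ∧ p.2 ∈ T₀ ∧ p.1 * p.2 = h}.ncard
        + {p : H × H | p.1 ∈ T₁ ∧ p.2 ∈ T₁ ∧ p.1 * p.2 = h}.ncard
        + {t : H | t ∈ T₀ ∧ t ^ 2 = h}.ncard
        + {t : H | t ∈ T₁ ∧ t ^ 2 = h}.ncard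
        = 2 + if h = 1 then 2 * n else 0)

/-- `Xset T₀ T₁ i` is the set of `h ∈ H` appearing with coefficient `i` in `T̂⁽²⁾T₀`. -/
def Xset {H : Type*} [CommGroup H] (T₀ T₁ : Set H) (i : ℕ) : Set H :=
  {h : H | {p : H × H | p.1 ∈ T₀ ∪ T₁ ∧ p.2 ∈ T₀ ∧ p.1 ^ 2 * p.2 = h}.ncard = i}

/-- `Yset T₀ T₁ i` is the set of `h ∈ H` appearing with coefficient `i` in `T̂⁽²⁾T₁`. -/
def Yset {H : Type*} [CommGroup H] (T₀ T₁ : Set H) (i : ℕ) : Set H :=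
  {h : H | {p : H × H | p.1 ∈ T₀ ∪ T₁ ∧ p.2 ∈ T₁ ∧ p.1 ^ 2 * p.2 = h}.ncard = i}

/-- `Vset T₀ T₁ i` is the set of `h ∈ H` appearing with coefficient `i` in `T̂⁽⁴⁾T₁`. -/
def Vset {H : Type*} [CommGroup H] (T₀ T₁ : Set H) (i : ℕ) : Set H :=
  {h : H | {p : H × H | p.1 ∈ T₀ ∪ T₁ ∧ p.2 ∈ T₁ ∧ p.1 ^ 4 * p.2 = h}.ncard = i}

/-- `θ₀ = |(T₀T₀ ∖ T₀⁽²⁾) ∩ T̂⁽⁴⁾|`. -/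
noncomputable def theta0 {H : Type*} [CommGroup H] (T₀ T₁ : Set H) : ℕ :=
  (((T₀ * T₀) \ ((fun t => t ^ 2) '' T₀)) ∩ ((fun g => g ^ 4) '' (T₀ ∪ T₁))).ncard

/-- `θ₁ = |T₁ ∩ T̂⁽²⁾|/2 + |(T₁T₁ ∖ (T₁⁽²⁾ ∪ {e})) ∩ T̂⁽⁴⁾|`, as a rational number. -/
noncomputable def theta1 {H : Type*} [CommGroup H] (T₀ T₁ : Set H) : ℚ :=
  ((T₁ ∩ ((fun g => g ^ 2) '' (T₀ ∪ T₁))).ncard : ℚ) / 2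
    + ((((T₁ * T₁) \ (((fun t => t ^ 2) '' T₁) ∪ {1}))
        ∩ ((fun g => g ^ 4) '' (T₀ ∪ T₁))).ncard : ℚ)

/-- `s_i = (i−1)(i−4)/2` if `i ≡ 1 (mod 3)`, and `(i−2)(i−3)/2` otherwise. -/
def sCoef (i : ℕ) : ℚ :=
  if i % 3 = 1 then ((i : ℚ) - 1) * ((i : ℚ) - 4) / 2
  else ((i : ℚ) - 2) * ((i : ℚ) - 3) / 2

namespace MonoidAlgebra

section Coefficients

variable {H : Type*} [CommGroup H]

/-- The group-ring element `∑_{t ∈ T} t ^ k`. -/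
noncomputable def powSum (T : Finset H) (k : ℕ) : MonoidAlgebra ℤ H :=
  ∑ t ∈ T, single (t ^ k) 1

lemma coeff_powSum (T : Finset H) (k : ℕ) (h : H) :
    (powSum T k).coeff h = ({t ∈ T | t ^ k = h}.card : ℤ) := by
  simp [powSum, coeff_sum, coeff_single, Finsupp.single_apply, Finset.sum_boole]

lemma coeff_powSum_one (T : Finset H) (h : H) :
    (powSum T 1).coeff h = if h ∈ T then 1 else 0 := by
  simp [powSum, coeff_sum, coeff_single, Finsupp.single_apply]

lemma coeff_powSum_mul (S T : Finset H) (h : H) :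
    (powSum S 1 * powSum T 1).coeff h
      = ({p : H × H | p.1 ∈ S ∧ p.2 ∈ T ∧ p.1 * p.2 = h}.ncard : ℤ) := by
  have hset : {p : H × H | p.1 ∈ S ∧ p.2 ∈ T ∧ p.1 * p.2 = h}
      = ↑{p ∈ S ×ˢ T | p.1 * p.2 = h} := by
    ext p; simp [and_assoc]
  rw [hset, Set.ncard_coe_finset, powSum, powSum, Finset.sum_mul_sum, ← Finset.sum_product']
  simp [coeff_sum, coeff_single, Finsupp.single_apply, Finset.sum_boole, single_mul_single]

lemma coeff_powSum_nonneg (T : Finset H) (k : ℕ) (h : H) : 0 ≤ (powSum T k).coeff h := by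
  rw [coeff_powSum]; positivity

lemma coeff_mul_nonneg {x y : MonoidAlgebra ℤ H} (hx : ∀ h, 0 ≤ x.coeff h)
    (hy : ∀ h, 0 ≤ y.coeff h) (h : H) : 0 ≤ (x * y).coeff h := by
  rw [coeff_mul]
  refine Finset.sum_nonneg fun a _ => Finset.sum_nonneg fun b _ => ?_
  dsimp only
  split_ifs
  · exact mul_nonneg (hx a) (hy b)
  · exact le_rfl

lemma mapDomainRingHom_pow_powSum (T : Finset H) (j k : ℕ) :
    mapDomainRingHom ℤ (powMonoidHom j : H →* H) (powSum T k) = powSum T (k * j) := by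
  simp [powSum, pow_mul]

/-- Frobenius: modulo a prime `p`, the `p`-th power of `∑_{t ∈ T} t` is `∑_{t ∈ T} t ^ p`. -/
lemma dvd_coeff_powSum_pow_sub (p : ℕ) [Fact p.Prime] (T : Finset H) (h : H) :
    (p : ℤ) ∣ (powSum T 1 ^ p).coeff h - (powSum T p).coeff h := by
  have : CharP (MonoidAlgebra (ZMod p) H) p :=
    charP_of_injective_algebraMap' (ZMod p) p
  have key : mapRingHom H (Int.castRingHom (ZMod p)) (powSum T 1 ^ p)
      = mapRingHom H (Int.castRingHom (ZMod p)) (powSum T p) := by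
    simp [powSum, sum_pow_char, single_pow]
  have := congrArg (fun x => x.coeff h) key
  rw [← Int.modEq_iff_dvd, ← ZMod.intCast_eq_intCast_iff]
  simpa only [coeff_mapRingHom, eq_intCast] using this.symm

lemma dvd_coeff_powSum_pow (p : ℕ) [Fact p.Prime] (T : Finset H) {h : H}
    (hh : h ∉ T.image (· ^ p)) : (p : ℤ) ∣ (powSum T 1 ^ p).coeff h := by
  have h0 : (powSum T p).coeff h = 0 := by
    rw [coeff_powSum]
    simpa [Finset.filter_eq_empty_iff] using hh
  simpa [h0] using dvd_coeff_powSum_pow_sub p T h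

lemma coeff_powSum_inv {T : Finset H} (hT : ∀ t, t⁻¹ ∈ T ↔ t ∈ T) (k : ℕ) (h : H) :
    (powSum T k).coeff h⁻¹ = (powSum T k).coeff h := by
  rw [coeff_powSum, coeff_powSum, Nat.cast_inj]
  exact Finset.card_equiv (Equiv.inv H) fun t => by simp [hT, inv_eq_iff_eq_inv]

/-- The sum of the coefficients. -/
noncomputable def augmentation (H : Type*) [CommGroup H] : MonoidAlgebra ℤ H →ₐ[ℤ] ℤ :=
  lift ℤ ℤ H 1

lemma augmentation_powSum (T : Finset H) (k : ℕ) : augmentation H (powSum T k) = T.card := by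
  simp [augmentation, powSum]

variable [Fintype H]

lemma sum_coeff_eq_augmentation (x : MonoidAlgebra ℤ H) :
    ∑ h, x.coeff h = augmentation H x := by
  rw [augmentation, lift_apply, Finsupp.sum_fintype] <;> simp

lemma mul_powSum_univ (x : MonoidAlgebra ℤ H) :
    x * powSum Finset.univ 1 = (augmentation H x : MonoidAlgebra ℤ H) * powSum Finset.univ 1 := by
  rw [← zsmul_eq_mul]
  ext h
  rw [coeff_mul_apply_left, Finsupp.sum_fintype, ← sum_coeff_eq_augmentation, coeff_smul_apply]
    <;> simp [coeff_powSum_one]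

lemma coeff_mul_self_one {x : MonoidAlgebra ℤ H} (hx : ∀ h, x.coeff h⁻¹ = x.coeff h) :
    (x * x).coeff 1 = ∑ h, x.coeff h ^ 2 := by
  rw [coeff_mul_apply_left, Finsupp.sum_fintype] <;> simp [hx, sq]

lemma powSum_univ_of_coprime {k : ℕ} (hk : (Nat.card H).Coprime k) :
    powSum (Finset.univ : Finset H) k = powSum Finset.univ 1 := by
  rw [powSum, powSum]
  exact Fintype.sum_equiv (powCoprime hk) _ _ fun t => by simp

lemma coeff_mul_inv {x y : MonoidAlgebra ℤ H} (hx : ∀ h, x.coeff h⁻¹ = x.coeff h)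
    (hy : ∀ h, y.coeff h⁻¹ = y.coeff h) (h : H) : (x * y).coeff h⁻¹ = (x * y).coeff h := by
  rw [coeff_mul_apply_left, coeff_mul_apply_left, Finsupp.sum_fintype _ _ (by simp),
    Finsupp.sum_fintype _ _ (by simp)]
  refine Fintype.sum_equiv (Equiv.inv H) _ _ fun t => ?_
  rw [Equiv.inv_apply, hx, ← hy (t⁻¹⁻¹ * h)]
  simp [mul_comm]

end Coefficients

section Identities

variable {R : Type*} [CommRing R] {n u p q p₂ q₂ p₄ q₄ : R}

lemma mul_left_identity (hpu : p * u = n * u) (hqu : q * u = (n + 1) * u) (hpq : p * q = u - 1)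
    (hsq : p ^ 2 + q ^ 2 = 2 * u - p₂ - q₂ + 2 * n) :
    (p₂ + q₂) * p = (n - 1) * u - p ^ 3 + q + 2 * n * p := by
  linear_combination p * hsq + 2 * hpu - q * hpq - hqu

lemma mul_right_identity (hpu : p * u = n * u) (hqu : q * u = (n + 1) * u) (hpq : p * q = u - 1)
    (hsq : p ^ 2 + q ^ 2 = 2 * u - p₂ - q₂ + 2 * n) :
    (p₂ + q₂) * q = (n + 2) * u - q ^ 3 + p + 2 * n * q := by
  linear_combination q * hsq + 2 * hqu - p * hpq - hpu

lemma fourth_power_identity (hpu : p * u = n * u) (hqu : q * u = (n + 1) * u)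
    (hpq : p * q = u - 1) (hsq : p ^ 2 + q ^ 2 = 2 * u - p₂ - q₂ + 2 * n)
    (hp₂u : (p₂ + q₂) * u = (2 * n + 1) * u)
    (hsq₂ : (p₂ + q₂) ^ 2 = 4 * u - (p₄ + q₄) + 2 * n - 2) :
    (p₄ + q₄) * q = (n ^ 3 + 4 * n ^ 2 + 9 * n + 5) * u - q ^ 5
      + (4 * n ^ 2 + 2 * n - 3) * q + 2 * n * p - (p₂ + q₂) * p - 4 * n * ((p₂ + q₂) * q) := by
  have hq := mul_right_identity hpu hqu hpq hsq
  linear_combination q * hsq₂ + 4 * hqu - (p₂ + q₂) * hq - (n + 2) * hp₂u + q ^ 2 * hq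
    + (n + 2) * (q + n + 1) * hqu + q * hpq + hqu + 2 * n * hq

end Identities

end MonoidAlgebra

/-- If `a = 1 + 3i` and `b = 1 + 3j`, then `v ≡ 2 + 2i - j (mod 5)`, and `v ≥ 2 + 2i - j` up to an
error controlled by `(a - 1) * (a - 4) = 9 * i * (i - 1)`. -/
lemma APLL.weight_le_of_residues {a b v : ℤ} (ha0 : 0 ≤ a) (hb0 : 0 ≤ b) (hv0 : 0 ≤ v)
    (ha : a % 3 = 1) (hb : b % 3 = 1) (hv : (v + a + 2 * b) % 5 = 0) :
    30 + 12 * a - 6 * b ≤ 18 * v + 5 * (a ^ 2 - 5 * a + 4) := by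
  obtain ⟨i, rfl⟩ : ∃ i, a = 1 + 3 * i := ⟨a / 3, by omega⟩
  obtain ⟨j, rfl⟩ : ∃ j, b = 1 + 3 * j := ⟨b / 3, by omega⟩
  obtain ⟨k, rfl⟩ : ∃ k, v = 2 + 2 * i - j + 5 * k := ⟨(v - (2 + 2 * i - j)) / 5, by omega⟩
  have hi : 0 ≤ i := by omega
  suffices 0 ≤ 2 * k + i * (i - 1) by nlinarith
  rcases le_or_gt 3 i with h | h
  · nlinarith
  · interval_cases i <;> omega

lemma APLL.weight_le {a b v : ℤ} (hb0 : 0 ≤ b) (hv0 : 0 ≤ v) :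
    30 + 12 * a - 6 * b ≤ 18 * v + 5 * (a ^ 2 - 5 * a + 4) + 78 := by
  rcases le_or_gt a 3 with h | h
  · nlinarith
  · nlinarith [mul_nonneg (sub_nonneg.2 (Int.add_one_le_iff.2 h)) (sub_nonneg.2 h.le)]

lemma APLL.card_eq {n a b : ℤ} (hn : 0 < n) (hodd : Odd n) (ha : 0 ≤ a) (hb : 0 ≤ b)
    (hmul : a * b = n ^ 2 + n)
    (hsq : a ^ 2 + b ^ 2 = 2 * (n ^ 2 + n + 1) - a - b + 2 * n) (haodd : Odd a) :
    a = n ∧ b = n + 1 := by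
  have hs : a + b = 2 * n + 1 := by
    have : (a + b - (2 * n + 1)) * (a + b + 2 * n + 2) = 0 := by linear_combination hsq + 2 * hmul
    rcases mul_eq_zero.1 this with h | h <;> omega
  obtain rfl : b = 2 * n + 1 - a := by omega
  have : (a - n) * (a - (n + 1)) = 0 := by linear_combination -hmul
  rcases mul_eq_zero.1 this with h | h
  · omega
  · obtain ⟨k, rfl⟩ := hodd
    obtain ⟨l, rfl⟩ := haodd
    omega

open MonoidAlgebra in
/-- No finite sets `S ∋ 1` and `T` satisfy the group-ring equations. -/
lemma APLL.not_groupRing_equations {n : ℕ} (hodd : Odd n) (hge : 154 ≤ n) (h5 : n % 5 = 3)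
    (h3 : n % 3 = 2) {H : Type*} [CommGroup H] [Fintype H]
    (hcard : Fintype.card H = n ^ 2 + n + 1) {S T : Finset H}
    (hS : ∀ t, t⁻¹ ∈ S ↔ t ∈ S) (hT : ∀ t, t⁻¹ ∈ T ↔ t ∈ T) (h1 : (1 : H) ∈ S)
    (hmul : powSum S 1 * powSum T 1 = powSum Finset.univ 1 - 1)
    (hsq : powSum S 1 ^ 2 + powSum T 1 ^ 2
      = 2 * powSum Finset.univ 1 - powSum S 2 - powSum T 2 + 2 * (n : MonoidAlgebra ℤ H)) :
    False := by
  have hcop2 : (Nat.card H).Coprime 2 := by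
    rw [Nat.card_eq_fintype_card, hcard, Nat.coprime_two_right]
    exact ⟨(n ^ 2 + n) / 2, by have := Nat.even_mul_succ_self n; grind⟩
  -- the cardinalities of `S` and `T`
  have hsqS : (powSum S 1 ^ 2).coeff 1 = S.card := by
    rw [sq, coeff_mul_self_one (coeff_powSum_inv hS 1)]
    simp [coeff_powSum_one]
  have hSodd : Odd (S.card : ℤ) := by
    have := Fact.mk Nat.prime_two
    have hdvd := dvd_coeff_powSum_pow_sub 2 S 1
    have hone : (powSum S 2).coeff 1 = 1 := by
      have : ({t ∈ S | t ^ 2 = 1} : Finset H) = {1} := by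
        ext t
        simp only [Finset.mem_filter, Finset.mem_singleton]
        refine ⟨fun ht => ?_, fun ht => by simp [ht, h1]⟩
        exact (powCoprime hcop2).injective (by simpa using ht.2)
      simp [coeff_powSum, this]
    rw [hsqS, hone] at hdvd
    rw [Int.odd_iff]; push_cast at hdvd; omega
  have haug (x : Finset H) (k : ℕ) := augmentation_powSum x k
  obtain ⟨hSn, hTn⟩ : (S.card : ℤ) = n ∧ (T.card : ℤ) = n + 1 := by
    have e1 := congrArg (augmentation H) hmul
    have e2 := congrArg (augmentation H) hsq
    simp only [map_mul, map_sub, map_add, map_pow, map_one, map_natCast, map_ofNat, haug,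
      Finset.card_univ, hcard] at e1 e2
    push_cast at e1 e2
    exact APLL.card_eq (by omega) (by exact_mod_cast hodd) (by positivity) (by positivity)
      (by linarith) (by linarith) hSodd
  -- the group-ring identities
  set u : MonoidAlgebra ℤ H := powSum Finset.univ 1 with hu
  set p := powSum S 1 with hp
  set q := powSum T 1 with hq
  set r := powSum S 2 + powSum T 2 with hr
  set w := powSum S 4 + powSum T 4 with hw
  have hpu : p * u = (n : MonoidAlgebra ℤ H) * u := by
    rw [hu, mul_powSum_univ, hp, haug, hSn]; simp
  have hqu : q * u = ((n : MonoidAlgebra ℤ H) + 1) * u := by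
    rw [hu, mul_powSum_univ, hq, haug, hTn]; simp
  have hru : r * u = (2 * (n : MonoidAlgebra ℤ H) + 1) * u := by
    rw [hu, mul_powSum_univ, hr, map_add, haug, haug, hSn, hTn]; push_cast; ring
  have hr2 : r ^ 2 = 4 * u - w + 2 * (n : MonoidAlgebra ℤ H) - 2 := by
    have e : (p + q) ^ 2 = 4 * u - r + 2 * (n : MonoidAlgebra ℤ H) - 2 := by
      linear_combination hsq + 2 * hmul
    have := congrArg (mapDomainRingHom ℤ (powMonoidHom 2 : H →* H)) e
    simpa only [hp, hq, hu, hr, hw, map_pow, map_add, map_sub, map_mul, map_ofNat, map_natCast,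
      mapDomainRingHom_pow_powSum, powSum_univ_of_coprime hcop2, one_mul, Nat.reduceMul] using this
  have hA := mul_left_identity hpu hqu hmul hsq
  have hB := mul_right_identity hpu hqu hmul hsq
  have hV := fourth_power_identity hpu hqu hmul hsq hru hr2
  rw [← hr] at hA hB hV
  rw [← hw] at hV
  have hr0 (h : H) : 0 ≤ r.coeff h := by
    simpa [hr] using add_nonneg (coeff_powSum_nonneg S 2 h) (coeff_powSum_nonneg T 2 h)
  have hw0 (h : H) : 0 ≤ w.coeff h := by
    simpa [hw] using add_nonneg (coeff_powSum_nonneg S 4 h) (coeff_powSum_nonneg T 4 h)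
  have hp0 : ∀ h, 0 ≤ p.coeff h := coeff_powSum_nonneg S 1
  have hq0 : ∀ h, 0 ≤ q.coeff h := coeff_powSum_nonneg T 1
  have ha0 := coeff_mul_nonneg hr0 hp0
  have hb0 := coeff_mul_nonneg hr0 hq0
  have hv0 := coeff_mul_nonneg hw0 hq0
  -- moments
  have hcardZ : (Fintype.card H : ℤ) = n ^ 2 + n + 1 := by exact_mod_cast hcard
  have hsumA : ∑ h, (r * p).coeff h = (2 * n + 1) * n := by
    rw [sum_coeff_eq_augmentation, map_mul, hr, map_add, haug, haug, haug, hSn, hTn]; ring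
  have hsumB : ∑ h, (r * q).coeff h = (2 * n + 1) * (n + 1) := by
    rw [sum_coeff_eq_augmentation, map_mul, hr, map_add, haug, haug, haug, hSn, hTn]; ring
  have hsumV : ∑ h, (w * q).coeff h = (2 * n + 1) * (n + 1) := by
    rw [sum_coeff_eq_augmentation, map_mul, hw, map_add, haug, haug, haug, hSn, hTn]; ring
  have hsumA2 : ∑ h, (r * p).coeff h ^ 2 ≤ 6 * n ^ 2 - 2 * n := by
    have hrinv (h : H) : r.coeff h⁻¹ = r.coeff h := by
      simp [hr, coeff_powSum_inv hS, coeff_powSum_inv hT]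
    rw [← coeff_mul_self_one (coeff_mul_inv hrinv (coeff_powSum_inv hS 1))]
    have e : r * p * (r * p) = (4 * n ^ 2 : ℤ) • u + (2 * n - 2 : ℤ) • p ^ 2 - w * (p * p) := by
      simp only [zsmul_eq_mul]
      push_cast
      linear_combination p ^ 2 * hr2 + 4 * (p + n) * hpu
    have hnn := coeff_mul_nonneg hw0 (coeff_mul_nonneg hp0 hp0) 1
    have hu1 : u.coeff 1 = 1 := by simp [hu, coeff_powSum_one]
    rw [e]
    simp only [coeff_sub, coeff_add, Finsupp.coe_add, Finsupp.coe_sub, Pi.add_apply, Pi.sub_apply,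
      coeff_smul_apply, hu1, hsqS, hSn, smul_eq_mul]
    nlinarith
  -- residues away from a small exceptional set
  set E : Finset H := S ∪ T ∪ S.image (· ^ 3) ∪ T.image (· ^ 3) ∪ T.image (· ^ 5) with hE
  have hEcard : (E.card : ℤ) ≤ 5 * n + 3 := by
    have : E.card ≤ S.card + T.card + S.card + T.card + T.card := by
      refine (Finset.card_union_le _ _).trans (add_le_add ?_ Finset.card_image_le)
      refine (Finset.card_union_le _ _).trans (add_le_add ?_ Finset.card_image_le)
      refine (Finset.card_union_le _ _).trans (add_le_add ?_ Finset.card_image_le)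
      exact Finset.card_union_le _ _
    zify at this
    linarith
  have hgen (h : H) (hh : h ∉ E) : (r * p).coeff h % 3 = 1 ∧ (r * q).coeff h % 3 = 1 ∧
      ((w * q).coeff h + (r * p).coeff h + 2 * (r * q).coeff h) % 5 = 0 := by
    simp only [hE, Finset.mem_union, not_or] at hh
    obtain ⟨⟨⟨⟨hhS, hhT⟩, hS3⟩, hT3⟩, hT5⟩ := hh
    have := Fact.mk Nat.prime_three
    have := Fact.mk Nat.prime_five
    have hph : p.coeff h = 0 := by simp [hp, coeff_powSum_one, hhS]
    have hqh : q.coeff h = 0 := by simp [hq, coeff_powSum_one, hhT]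
    have huh : u.coeff h = 1 := by simp [hu, coeff_powSum_one]
    have hdS3 := dvd_coeff_powSum_pow 3 S hS3
    have hdT3 := dvd_coeff_powSum_pow 3 T hT3
    have hdT5 := dvd_coeff_powSum_pow 5 T hT5
    have eA : r * p = (n - 1 : ℤ) • u - p ^ 3 + q + (2 * n : ℤ) • p := by
      simp only [zsmul_eq_mul]; push_cast; exact hA
    have eB : r * q = (n + 2 : ℤ) • u - q ^ 3 + p + (2 * n : ℤ) • q := by
      simp only [zsmul_eq_mul]; push_cast; exact hB
    have eV : w * q = (n ^ 3 + 4 * n ^ 2 + 9 * n + 5 : ℤ) • u - q ^ 5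
        + (4 * n ^ 2 + 2 * n - 3 : ℤ) • q + (2 * n : ℤ) • p - r * p
        - (4 * n : ℤ) • (r * q) := by
      simp only [zsmul_eq_mul]; push_cast; exact hV
    have cA := congrArg (fun x => x.coeff h) eA
    have cB := congrArg (fun x => x.coeff h) eB
    have cV := congrArg (fun x => x.coeff h) eV
    simp only [coeff_sub, coeff_add, Finsupp.coe_add, Finsupp.coe_sub, Pi.add_apply, Pi.sub_apply,
      coeff_smul_apply, huh, hph, hqh, smul_eq_mul, mul_zero, mul_one,
      add_zero] at cA cB cV
    push_cast at hdS3 hdT3 hdT5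
    refine ⟨?_, ?_, ?_⟩
    · obtain ⟨k, hk⟩ := hdS3
      rw [cA, hk]; omega
    · obtain ⟨k, hk⟩ := hdT3
      rw [cB, hk]; omega
    obtain ⟨m, hm⟩ : ∃ m : ℤ, (n : ℤ) = 5 * m + 3 := ⟨n / 5, by omega⟩
    obtain ⟨k, hk⟩ := hdT5
    rw [hk, hm] at cV
    rw [cV]
    generalize (r * q).coeff h = b
    refine Int.emod_eq_zero_of_dvd
      ⟨25 * m ^ 3 + 65 * m ^ 2 + 60 * m + 19 - k - (4 * m + 2) * b, by ring⟩
  have hpt (h : H) : 30 + 12 * (r * p).coeff h - 6 * (r * q).coeff h ≤ 18 * (w * q).coeff h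
      + 5 * ((r * p).coeff h ^ 2 - 5 * (r * p).coeff h + 4) + if h ∈ E then 78 else 0 := by
    split_ifs with hh
    · exact APLL.weight_le (hb0 h) (hv0 h)
    · obtain ⟨h₁, h₂, h₃⟩ := hgen h hh
      simpa using APLL.weight_le_of_residues (ha0 h) (hb0 h) (hv0 h) h₁ h₂ h₃
  have hsum := Finset.sum_le_sum fun h (_ : h ∈ Finset.univ) => hpt h
  simp only [Finset.sum_add_distrib, Finset.sum_sub_distrib, ← Finset.mul_sum, hsumA, hsumB, hsumV,
    Finset.sum_const, Finset.card_univ, nsmul_eq_mul, hcardZ, Finset.sum_ite_mem,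
    Finset.univ_inter] at hsum
  have : (154 : ℤ) ≤ n := by exact_mod_cast hge
  nlinarith

/-- Nonexistence of inverse-closed subsets `T₀, T₁` with `e ∈ T₀` satisfying the
APLL group-ring equations, in any finite abelian group of order `n²+n+1`. -/
theorem no_APLL_subsets_odd_ge154_3mod5_2mod3 (n : ℕ) (hn : 0 < n)
    (hodd : Odd n) (hge : 154 ≤ n) (h5 : n % 5 = 3) (h3 : n % 3 = 2)
    (H : Type*) [CommGroup H] [Fintype H]
    (hcard : Fintype.card H = n ^ 2 + n + 1) :
    ¬ ∃ T₀ T₁ : Set H,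
        T₀⁻¹ = T₀ ∧ T₁⁻¹ = T₁ ∧ (1 : H) ∈ T₀ ∧ APLLEqs n T₀ T₁ := by
  rintro ⟨T₀, T₁, hT₀, hT₁, h1, hmul, hsq⟩
  have hinv {T : Set H} (hT : T⁻¹ = T) (t : H) : t⁻¹ ∈ T.toFinset ↔ t ∈ T.toFinset := by
    rw [Set.mem_toFinset, Set.mem_toFinset, ← Set.mem_inv, hT]
  have hprod (S T : Set H) (h : H) :
      (MonoidAlgebra.powSum S.toFinset 1 * MonoidAlgebra.powSum T.toFinset 1).coeff h
        = ({p : H × H | p.1 ∈ S ∧ p.2 ∈ T ∧ p.1 * p.2 = h}.ncard : ℤ) := by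
    simp [MonoidAlgebra.coeff_powSum_mul]
  have hpow (T : Set H) (h : H) : (MonoidAlgebra.powSum T.toFinset 2).coeff h
      = ({t : H | t ∈ T ∧ t ^ 2 = h}.ncard : ℤ) := by
    rw [MonoidAlgebra.coeff_powSum, ← Set.ncard_coe_finset]
    simp
  refine APLL.not_groupRing_equations hodd hge h5 h3 hcard (hinv hT₀) (hinv hT₁)
    (by simpa using h1) ?_ ?_
  · ext h
    rw [hprod, hmul h, MonoidAlgebra.coeff_sub, Finsupp.sub_apply,
      MonoidAlgebra.coeff_powSum_one, MonoidAlgebra.one_def, MonoidAlgebra.coeff_single,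
      Finsupp.single_apply]
    by_cases hh : h = 1 <;> simp [hh, eq_comm]
  · ext h
    have := hsq h
    zify at this
    rw [← hprod, ← hprod, ← hpow, ← hpow] at this
    have hn' : (2 * (n : MonoidAlgebra ℤ H)) = (2 * n : ℤ) • 1 := by
      rw [zsmul_eq_mul]; push_cast; ring
    have hone : (1 : MonoidAlgebra ℤ H).coeff h = if h = 1 then 1 else 0 := by
      rw [MonoidAlgebra.one_def, MonoidAlgebra.coeff_single, Finsupp.single_apply]
      simp [eq_comm]
    simp only [hn', sq, two_mul, MonoidAlgebra.coeff_sub, MonoidAlgebra.coeff_add, Finsupp.coe_add,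
      Finsupp.coe_sub, Pi.add_apply, Pi.sub_apply, MonoidAlgebra.coeff_smul_apply, hone,
      MonoidAlgebra.coeff_powSum_one, Finset.mem_univ, if_true]
    split_ifs at this ⊢ <;> simp at this ⊢ <;> linarith
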